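/- arXiv:2012.08445 — 2 statements merged into one kernel-verified Lean document; each statement's English description precedes it below -/
import Mathlib

section
/- Let {|ĩ⟩}_{i=1}^r be an orthonormal family in ℂ^{d1}⊗ℂ^{d2}⊗ℂ^{d3} and assume the recovery condition holds for all three parties P_1, P_2, P_3. Then every density matrix ρ̃ supported in span{|ĩ⟩} satisfies I₃(P1:P2:P3)(ρ̃) = −2 S(ρ̃). -/
open Matrix MeasureTheory ProbabilityTheory
open scoped ComplexOrder BigOperators

noncomputable section

/-- von Neumann entropy (natural logarithm), via the eigenvalues of a Hermitian matrix;
`Real.log 0 = 0` implements the convention `0 · log 0 = 0`. -/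
def vN {n : Type*} [Fintype n] [DecidableEq n] (ρ : Matrix n n ℂ) : ℝ :=
  if h : ρ.IsHermitian then -∑ k, h.eigenvalues k * Real.log (h.eigenvalues k) else 0

/-- `ρ` is a density matrix: positive semidefinite with unit trace. -/
def IsDensity {n : Type*} [Fintype n] [DecidableEq n] (ρ : Matrix n n ℂ) : Prop :=
  ρ.PosSemidef ∧ ρ.trace = 1

section reds
variable {α β γ : Type*} [Fintype α] [Fintype β] [Fintype γ]

/-- reduced density on party 1 (partial trace over parties 2, 3) -/
def red1 (ρ : Matrix (α × β × γ) (α × β × γ) ℂ) : Matrix α α ℂ :=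
  Matrix.of fun a a' => ∑ b, ∑ c, ρ (a, b, c) (a', b, c)
/-- reduced density on party 2 -/
def red2 (ρ : Matrix (α × β × γ) (α × β × γ) ℂ) : Matrix β β ℂ :=
  Matrix.of fun b b' => ∑ a, ∑ c, ρ (a, b, c) (a, b', c)
/-- reduced density on party 3 -/
def red3 (ρ : Matrix (α × β × γ) (α × β × γ) ℂ) : Matrix γ γ ℂ :=
  Matrix.of fun c c' => ∑ a, ∑ b, ρ (a, b, c) (a, b, c')
/-- reduced density on parties 1, 2 (partial trace over party 3) -/
def red12 (ρ : Matrix (α × β × γ) (α × β × γ) ℂ) : Matrix (α × β) (α × β) ℂ :=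
  Matrix.of fun x y => ∑ c, ρ (x.1, x.2, c) (y.1, y.2, c)
/-- reduced density on parties 1, 3 -/
def red13 (ρ : Matrix (α × β × γ) (α × β × γ) ℂ) : Matrix (α × γ) (α × γ) ℂ :=
  Matrix.of fun x y => ∑ b, ρ (x.1, b, x.2) (y.1, b, y.2)
/-- reduced density on parties 2, 3 -/
def red23 (ρ : Matrix (α × β × γ) (α × β × γ) ℂ) : Matrix (β × γ) (β × γ) ℂ :=
  Matrix.of fun x y => ∑ a, ρ (a, x.1, x.2) (a, y.1, y.2)

/-- tripartite information I₃(P1:P2:P3) -/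
def I3 [DecidableEq α] [DecidableEq β] [DecidableEq γ]
    (ρ : Matrix (α × β × γ) (α × β × γ) ℂ) : ℝ :=
  vN (red1 ρ) + vN (red2 ρ) + vN (red3 ρ)
    - vN (red12 ρ) - vN (red13 ρ) - vN (red23 ρ) + vN ρ
end reds

/-- rank-one operator |v⟩⟨w| -/
def outer {X : Type*} (v w : X → ℂ) : Matrix X X ℂ :=
  Matrix.of fun x y => v x * star (w y)

/-- orthonormal family of vectors -/
def ONFam {ι X : Type*} [DecidableEq ι] [Fintype X] (v : ι → X → ℂ) : Prop :=
  ∀ i j, (∑ x, star (v i x) * v j x) = if i = j then (1 : ℂ) else 0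

/-- the support (range) of `ρ` is contained in the span of the family `v` -/
def SuppIn {ι X : Type*} [Fintype X] (ρ : Matrix X X ℂ) (v : ι → X → ℂ) : Prop :=
  LinearMap.range ρ.mulVecLin ≤ Submodule.span ℂ (Set.range v)

/-- a (rectangular) matrix is unitary -/
def IsUnitaryM {A B : Type*} [Fintype A] [Fintype B] [DecidableEq A] [DecidableEq B]
    (U : Matrix A B ℂ) : Prop :=
  U * Uᴴ = 1 ∧ Uᴴ * U = 1

/-- operator norm (largest singular value) of a matrix -/
def opNorm {A B : Type*} [Fintype A] [Fintype B] [DecidableEq B]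
    (M : Matrix A B ℂ) : ℝ :=
  ‖LinearMap.toContinuousLinearMap (Matrix.toEuclideanLin M)‖

/-- trace norm: the sum of the singular values -/
def traceNorm {A B : Type*} [Fintype A] [Fintype B] [DecidableEq B]
    (M : Matrix A B ℂ) : ℝ :=
  ∑ k, Real.sqrt ((Matrix.posSemidef_conjTranspose_mul_self M).1.eigenvalues k)

/-- matrix logarithm taken on the support (eigenvalue `0 ↦ 0`, since `Real.log 0 = 0`) -/
def mlog {n : Type*} [Fintype n] [DecidableEq n] (ρ : Matrix n n ℂ) : Matrix n n ℂ :=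
  if h : ρ.IsHermitian then
    (h.eigenvectorUnitary : Matrix n n ℂ) *
      Matrix.diagonal (fun k => (Real.log (h.eigenvalues k) : ℂ)) *
      (h.eigenvectorUnitary : Matrix n n ℂ)ᴴ
  else 0

/-- quantum relative entropy D(ρ‖σ) = Tr(ρ (log ρ − log σ)) -/
def relEnt {n : Type*} [Fintype n] [DecidableEq n] (ρ σ : Matrix n n ℂ) : ℝ :=
  ((ρ * (mlog ρ - mlog σ)).trace).re

/-- the recovery condition for party `P₁`: there are a unitary
`U : ℂ^r ⊗ ℂ^{d1} → ℂ^{d2} ⊗ ℂ^{d3}` and a unit vector `χ ∈ ℂ^{d1} ⊗ ℂ^{d1}` with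
`|ĩ⟩ = (1_{P₁} ⊗ U)(|i⟩ ⊗ |χ⟩)` for all `i`. -/
def Rec1 {d1 d2 d3 r : ℕ} (v : Fin r → (Fin d1 × Fin d2 × Fin d3) → ℂ) : Prop :=
  ∃ (U : Matrix (Fin d2 × Fin d3) (Fin r × Fin d1) ℂ) (χ : Fin d1 × Fin d1 → ℂ),
    IsUnitaryM U ∧ (∑ x, star (χ x) * χ x) = 1 ∧
    ∀ i s1 s2 s3, v i (s1, s2, s3) = ∑ s', U (s2, s3) (i, s') * χ (s', s1)

/-- the recovery condition for party `P₂` -/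
def Rec2 {d1 d2 d3 r : ℕ} (v : Fin r → (Fin d1 × Fin d2 × Fin d3) → ℂ) : Prop :=
  ∃ (U : Matrix (Fin d1 × Fin d3) (Fin r × Fin d2) ℂ) (χ : Fin d2 × Fin d2 → ℂ),
    IsUnitaryM U ∧ (∑ x, star (χ x) * χ x) = 1 ∧
    ∀ i s1 s2 s3, v i (s1, s2, s3) = ∑ s', U (s1, s3) (i, s') * χ (s', s2)

/-- the recovery condition for party `P₃` -/
def Rec3 {d1 d2 d3 r : ℕ} (v : Fin r → (Fin d1 × Fin d2 × Fin d3) → ℂ) : Prop :=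
  ∃ (U : Matrix (Fin d1 × Fin d2) (Fin r × Fin d3) ℂ) (χ : Fin d3 × Fin d3 → ℂ),
    IsUnitaryM U ∧ (∑ x, star (χ x) * χ x) = 1 ∧
    ∀ i s1 s2 s3, v i (s1, s2, s3) = ∑ s', U (s1, s2) (i, s') * χ (s', s3)

open scoped Kronecker

section entropy
variable {m n : Type*} [Fintype m] [DecidableEq m] [Fintype n] [DecidableEq n]

theorem vN_eq_sum_roots {ρ : Matrix n n ℂ} (h : ρ.IsHermitian) :
    vN ρ = -(ρ.charpoly.roots.map fun z => z.re * Real.log z.re).sum := by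
  rw [vN, dif_pos h, h.roots_charpoly_eq_eigenvalues, Multiset.map_map]
  simp [Function.comp_def, Finset.sum_map_val]

theorem vN_mul_comm {A : Matrix m n ℂ} {B : Matrix n m ℂ} (hAB : (A * B).IsHermitian)
    (hBA : (B * A).IsHermitian) : vN (A * B) = vN (B * A) := by
  have key := congrArg
    (fun p : Polynomial ℂ => (p.roots.map fun z => z.re * Real.log z.re).sum)
    (Matrix.charpoly_mul_comm' A B)
  have hX (k : ℕ) : (Polynomial.X ^ k : Polynomial ℂ) ≠ 0 := pow_ne_zero _ Polynomial.X_ne_zero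
  rw [vN_eq_sum_roots hAB, vN_eq_sum_roots hBA]
  rw [Polynomial.roots_mul (mul_ne_zero (hX _) (Matrix.charpoly_monic _).ne_zero),
    Polynomial.roots_mul (mul_ne_zero (hX _) (Matrix.charpoly_monic _).ne_zero)] at key
  simpa [Multiset.map_nsmul, Multiset.sum_nsmul] using key

theorem vN_conj_isometry {V : Matrix m n ℂ} (hV : Vᴴ * V = 1) {σ : Matrix n n ℂ}
    (hσ : σ.IsHermitian) : vN (V * σ * Vᴴ) = vN σ := by
  have h : σ * Vᴴ * V = σ := by rw [Matrix.mul_assoc, hV, Matrix.mul_one]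
  have hc : (V * σ * Vᴴ).IsHermitian := isHermitian_mul_mul_conjTranspose V hσ
  rw [Matrix.mul_assoc] at hc ⊢
  rw [vN_mul_comm hc (by rwa [h]), h]

theorem vN_transpose {ρ : Matrix n n ℂ} (h : ρ.IsHermitian) : vN ρᵀ = vN ρ := by
  rw [vN_eq_sum_roots h.transpose, vN_eq_sum_roots h, Matrix.charpoly_transpose]

theorem vN_diagonal (d : n → ℝ) :
    vN (Matrix.diagonal fun k => (d k : ℂ)) = -∑ k, d k * Real.log (d k) := by
  rw [vN_eq_sum_roots (by
    rw [Matrix.isHermitian_diagonal_iff]; intro i; simp [isSelfAdjoint_iff]),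
    Matrix.charpoly_diagonal, Polynomial.roots_prod _ _ (by
      simp [Finset.prod_ne_zero_iff, Polynomial.X_sub_C_ne_zero])]
  simp [Finset.sum_map_val]

theorem vN_kronecker {σ : Matrix m m ℂ} {τ : Matrix n n ℂ} (hσ : σ.IsHermitian)
    (hτ : τ.IsHermitian) (hσ1 : σ.trace = 1) (hτ1 : τ.trace = 1) :
    vN (σ ⊗ₖ τ) = vN σ + vN τ := by
  have hs : ∑ i, hσ.eigenvalues i = 1 := by
    simpa using congrArg Complex.re (hσ.trace_eq_sum_eigenvalues.symm.trans hσ1)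
  have ht : ∑ i, hτ.eigenvalues i = 1 := by
    simpa using congrArg Complex.re (hτ.trace_eq_sum_eigenvalues.symm.trans hτ1)
  set P : Matrix m m ℂ := ↑hσ.eigenvectorUnitary
  set Q : Matrix n n ℂ := ↑hτ.eigenvectorUnitary
  have hP : Pᴴ * P = 1 := Unitary.coe_star_mul_self hσ.eigenvectorUnitary
  have hQ : Qᴴ * Q = 1 := Unitary.coe_star_mul_self hτ.eigenvectorUnitary
  have hσP : σ = P * Matrix.diagonal (fun i => (hσ.eigenvalues i : ℂ)) * Pᴴ := hσ.spectral_theorem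
  have hτQ : τ = Q * Matrix.diagonal (fun i => (hτ.eigenvalues i : ℂ)) * Qᴴ := hτ.spectral_theorem
  have hdiag : σ ⊗ₖ τ = (P ⊗ₖ Q) * Matrix.diagonal
      (fun k : m × n => ((hσ.eigenvalues k.1 * hτ.eigenvalues k.2 : ℝ) : ℂ)) * (P ⊗ₖ Q)ᴴ := by
    conv_lhs => rw [hσP, hτQ]
    rw [Matrix.mul_kronecker_mul, Matrix.mul_kronecker_mul, Matrix.diagonal_kronecker_diagonal,
      Matrix.conjTranspose_kronecker]
    simp
  have hPQ : (P ⊗ₖ Q)ᴴ * (P ⊗ₖ Q) = 1 := by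
    rw [Matrix.conjTranspose_kronecker, ← Matrix.mul_kronecker_mul, hP, hQ,
      Matrix.one_kronecker_one]
  rw [hdiag, vN_conj_isometry hPQ (by
    rw [Matrix.isHermitian_diagonal_iff]; intro i; simp [isSelfAdjoint_iff]), vN_diagonal,
    vN, dif_pos hσ, vN, dif_pos hτ, Fintype.sum_prod_type]
  have hlog (x y : ℝ) : x * y * Real.log (x * y) = y * (x * Real.log x) + x * (y * Real.log y) := by
    rcases eq_or_ne x 0 with rfl | hx
    · simp
    rcases eq_or_ne y 0 with rfl | hy
    · simp
    rw [Real.log_mul hx hy]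
    ring
  simp only [hlog, Finset.sum_add_distrib, ← Finset.sum_mul, ← Finset.mul_sum, hs, ht, one_mul]
  ring

/-- The marginals of a code state `∑ σ i j |w i⟩⟨w j|` on two complementary parties `A`, `B`, when
`w i = (1 ⊗ U)(|i⟩ ⊗ |χ⟩)` is recoverable from `B`: the entropies differ by that of `σ`. -/
theorem vN_marginal_of_recovery {A B : Type*} [Fintype A] [DecidableEq A] [Fintype B]
    [DecidableEq B] {σ : Matrix n n ℂ} (hσ : σ.IsHermitian) (hσ1 : σ.trace = 1)
    {U : Matrix B (n × A) ℂ} (hU : Uᴴ * U = 1) {χ : A × A → ℂ}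
    (hχ : (∑ x, star (χ x) * χ x) = 1) {w : n → A → B → ℂ}
    (hw : ∀ i a b, w i a b = ∑ s, U b (i, s) * χ (s, a)) :
    vN (Matrix.of fun b b' => ∑ a, ∑ i, ∑ j, w i a b * σ i j * star (w j a b')) =
      vN σ + vN (Matrix.of fun a a' => ∑ b, ∑ i, ∑ j, w i a b * σ i j * star (w j a' b)) := by
  set X : Matrix A A ℂ := Matrix.of fun s a => χ (s, a) with hX
  set G : Matrix B (n × A) ℂ := U * ((1 : Matrix n n ℂ) ⊗ₖ X) with hG
  have hGw (i a b) : G b (i, a) = w i a b := by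
    simp [hG, hX, hw, Matrix.mul_apply, Fintype.sum_prod_type, Matrix.one_apply]
  have hGG : Gᴴ * G = (1 : Matrix n n ℂ) ⊗ₖ (Xᴴ * X) := by
    rw [hG, Matrix.conjTranspose_mul, Matrix.mul_assoc, ← Matrix.mul_assoc Uᴴ, hU, Matrix.one_mul,
      Matrix.conjTranspose_kronecker, ← Matrix.mul_kronecker_mul]
    simp
  have hXX : (Xᴴ * X).IsHermitian := isHermitian_conjTranspose_mul_self X
  have hXX' : (X * Xᴴ).IsHermitian := isHermitian_mul_conjTranspose_self X
  have htr : (X * Xᴴ).trace = 1 := by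
    rw [← hχ, Fintype.sum_prod_type]
    simp [Matrix.trace, Matrix.mul_apply, hX, mul_comm]
  have hB : (Matrix.of fun b b' => ∑ a, ∑ i, ∑ j, w i a b * σ i j * star (w j a b')) =
      U * (σ ⊗ₖ (X * Xᴴ)) * Uᴴ := by
    have : U * (σ ⊗ₖ (X * Xᴴ)) * Uᴴ = G * (σ ⊗ₖ (1 : Matrix A A ℂ)) * Gᴴ := by
      rw [hG, Matrix.conjTranspose_mul, Matrix.conjTranspose_kronecker]
      simp only [Matrix.mul_assoc]
      rw [← Matrix.mul_assoc (σ ⊗ₖ 1), ← Matrix.mul_kronecker_mul, ← Matrix.mul_assoc (1 ⊗ₖ X),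
        ← Matrix.mul_kronecker_mul]
      simp
    rw [this]
    ext b b'
    simp only [Matrix.of_apply, Matrix.mul_apply, Fintype.sum_prod_type, hGw,
      Matrix.kroneckerMap_apply, Matrix.one_apply, Matrix.conjTranspose_apply, mul_ite, mul_one,
      mul_zero, Finset.sum_ite_eq', Finset.mem_univ, if_true, Finset.sum_mul]
    rw [Finset.sum_comm]
    simp only [Finset.sum_comm (s := (Finset.univ : Finset A))]
    exact Finset.sum_comm
  have hA : (Matrix.of fun a a' => ∑ b, ∑ i, ∑ j, w i a b * σ i j * star (w j a' b)) =
      (Xᴴ * X)ᵀ := by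
    ext a a'
    have hij (i j) : ∑ b, w i a b * star (w j a' b) = if j = i then (Xᴴ * X) a' a else 0 := by
      have := congrFun (congrFun hGG (j, a')) (i, a)
      simpa [Matrix.mul_apply (M := Gᴴ), hGw, Matrix.one_apply, mul_comm] using this
    calc ∑ b, ∑ i, ∑ j, w i a b * σ i j * star (w j a' b)
        = ∑ i, ∑ j, σ i j * ∑ b, w i a b * star (w j a' b) := by
          simp only [Finset.mul_sum]
          rw [Finset.sum_comm]
          refine Finset.sum_congr rfl fun i _ => ?_
          rw [Finset.sum_comm]
          exact Finset.sum_congr rfl fun j _ => Finset.sum_congr rfl fun b _ => by ring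
      _ = σ.trace * (Xᴴ * X) a' a := by
          simp only [hij]
          simp [Matrix.trace, Finset.sum_mul]
      _ = (Xᴴ * X)ᵀ a a' := by rw [hσ1, one_mul, Matrix.transpose_apply]
  have hK : (σ ⊗ₖ (X * Xᴴ)).IsHermitian := by
    rw [Matrix.IsHermitian, Matrix.conjTranspose_kronecker, hσ.eq, hXX'.eq]
  rw [hB, hA, vN_transpose hXX, vN_conj_isometry hU hK, vN_kronecker hσ hXX' hσ1 htr,
    vN_mul_comm hXX' hXX]

/-- A Hermitian matrix supported in the span of an orthonormal family is the matrix of a Hermitian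
form on that family. -/
theorem exists_eq_conj_of_suppIn {v : n → m → ℂ} (hon : ONFam v) {ρ : Matrix m m ℂ}
    (hρ : ρ.IsHermitian) (hsupp : SuppIn ρ v) :
    ∃ V : Matrix m n ℂ, (∀ x i, V x i = v i x) ∧ Vᴴ * V = 1 ∧
      ∃ σ : Matrix n n ℂ, σ.IsHermitian ∧ ρ = V * σ * Vᴴ := by
  set V : Matrix m n ℂ := Matrix.of fun x i => v i x with hVdef
  have hV : Vᴴ * V = 1 := by
    ext i j
    simpa [Matrix.mul_apply, hVdef, Matrix.one_apply] using hon i j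
  have hcol (y : m) : ∃ c : n → ℂ, ∑ i, c i • v i = ρ.col y := by
    rw [← Submodule.mem_span_range_iff_exists_fun]
    exact hsupp ⟨Pi.single y 1, by simp⟩
  choose c hc using hcol
  have hfac : ρ = V * Matrix.of fun i y => c y i := by
    ext x y
    have := congrFun (hc y) x
    simp only [Finset.sum_apply, Pi.smul_apply, smul_eq_mul, Matrix.col_apply] at this
    simp [← this, Matrix.mul_apply, hVdef, mul_comm]
  have hfix : V * Vᴴ * ρ = ρ := by
    conv_lhs => rw [hfac, Matrix.mul_assoc, ← Matrix.mul_assoc Vᴴ, hV, Matrix.one_mul, ← hfac]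
  have hfix' : ρ * (V * Vᴴ) = ρ := by
    have := congrArg Matrix.conjTranspose hfix
    simpa [Matrix.conjTranspose_mul, hρ.eq, Matrix.mul_assoc] using this
  refine ⟨V, fun _ _ => rfl, hV, Vᴴ * ρ * V, isHermitian_conjTranspose_mul_mul V hρ, ?_⟩
  calc ρ = V * Vᴴ * ρ * (V * Vᴴ) := by rw [hfix, hfix']
    _ = V * (Vᴴ * ρ * V) * Vᴴ := by simp only [Matrix.mul_assoc]

end entropy

/-- if the recovery condition holds for all three parties, then every density
matrix `ρ̃` supported in the code space satisfies `I₃(P1:P2:P3)(ρ̃) = −2 S(ρ̃)`. -/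
theorem stmt3 (d1 d2 d3 r : ℕ)
    (v : Fin r → (Fin d1 × Fin d2 × Fin d3) → ℂ) (hon : ONFam v)
    (h1 : Rec1 v) (h2 : Rec2 v) (h3 : Rec3 v)
    (ρ : Matrix (Fin d1 × Fin d2 × Fin d3) (Fin d1 × Fin d2 × Fin d3) ℂ)
    (hρ : IsDensity ρ) (hsupp : SuppIn ρ v) :
    I3 ρ = -2 * vN ρ := by
  obtain ⟨U₁, χ₁, hU₁, hχ₁, hw₁⟩ := h1
  obtain ⟨U₂, χ₂, hU₂, hχ₂, hw₂⟩ := h2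
  obtain ⟨U₃, χ₃, hU₃, hχ₃, hw₃⟩ := h3
  obtain ⟨V, hVv, hV, σ, hσ, rfl⟩ := exists_eq_conj_of_suppIn hon hρ.1.1 hsupp
  have htr : σ.trace = 1 := by
    rw [← hρ.2, Matrix.trace_mul_comm, ← Matrix.mul_assoc, hV, Matrix.one_mul]
  have hentry (x y) : (V * σ * Vᴴ) x y = ∑ i, ∑ j, v i x * σ i j * star (v j y) := by
    simp only [Matrix.mul_apply, Matrix.conjTranspose_apply, hVv, Finset.sum_mul]
    exact Finset.sum_comm
  have e₁ := vN_marginal_of_recovery (w := fun i a (b : Fin d2 × Fin d3) => v i (a, b.1, b.2))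
    hσ htr hU₁.2 hχ₁ fun i a b => hw₁ i a b.1 b.2
  have e₂ := vN_marginal_of_recovery (w := fun i a (b : Fin d1 × Fin d3) => v i (b.1, a, b.2))
    hσ htr hU₂.2 hχ₂ fun i a b => hw₂ i b.1 a b.2
  have e₃ := vN_marginal_of_recovery (w := fun i a (b : Fin d1 × Fin d2) => v i (b.1, b.2, a))
    hσ htr hU₃.2 hχ₃ fun i a b => hw₃ i b.1 b.2 a
  simp only [Fintype.sum_prod_type] at e₁ e₂ e₃
  rw [I3, vN_conj_isometry hV hσ]
  simp only [red1, red2, red3, red12, red13, red23, hentry]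
  linarith
end
end

section
/- Let d ≥ 1 and let {|ĩ⟩}_{i=1}^d be an orthonormal family in (ℂ^d)⊗(ℂ^d)⊗(ℂ^d) such that ρ̃₀ = (1/d) ∑_i |ĩ⟩⟨ĩ| satisfies I₃(P1:P2:P3)(ρ̃₀) = −2 log d. Then for every density matrix ρ̃ supported in span{|ĩ⟩} and every party a ∈ {1,2,3}, the single-party reduced density of ρ̃ is maximally mixed: Tr_{P_bP_c} ρ̃ = (1/d)·I_d, where {b,c} = {1,2,3}∖{a}. -/
open Matrix MeasureTheory ProbabilityTheory
open scoped ComplexOrder BigOperators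

noncomputable section

theorem Matrix.IsHermitian.star_eigenvectorUnitary_mul_mul {n : Type*} [Fintype n] [DecidableEq n]
    {M : Matrix n n ℂ} (h : M.IsHermitian) :
    star (h.eigenvectorUnitary : Matrix n n ℂ) * M * (h.eigenvectorUnitary : Matrix n n ℂ) =
      diagonal fun k => (h.eigenvalues k : ℂ) := by
  have := h.conjStarAlgAut_star_eigenvectorUnitary
  rw [Unitary.conjStarAlgAut_star_apply] at this
  exact this

theorem vN_eq_sum_negMulLog {n : Type*} [Fintype n] [DecidableEq n] {M : Matrix n n ℂ}
    (h : M.IsHermitian) : vN M = ∑ k, Real.negMulLog (h.eigenvalues k) := by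
  simp [vN, h, Real.negMulLog]

theorem IsDensity.sum_eigenvalues {n : Type*} [Fintype n] [DecidableEq n] {M : Matrix n n ℂ}
    (h : IsDensity M) : ∑ k, h.1.1.eigenvalues k = 1 := by
  have := congr_arg Complex.re (h.2.symm.trans h.1.1.trace_eq_sum_eigenvalues)
  simpa using this.symm

/-- The entropy of a density matrix is at most the Shannon entropy of its diagonal in any
orthonormal basis. -/
theorem vN_le_sum_negMulLog_diag {n : Type*} [Fintype n] [DecidableEq n] {M : Matrix n n ℂ}
    (hM : M.PosSemidef) {W : Matrix n n ℂ} (hW : W ∈ unitary (Matrix n n ℂ)) :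
    vN M ≤ ∑ j, Real.negMulLog ((star W * M * W) j j).re := by
  have h := hM.1
  set U : Matrix n n ℂ := (h.eigenvectorUnitary : Matrix n n ℂ) with hU
  have hUu : U ∈ unitary (Matrix n n ℂ) := h.eigenvectorUnitary.2
  set Q := star U * W with hQ
  have hQu : Q ∈ unitary (Matrix n n ℂ) := mul_mem (Unitary.star_mem hUu) hW
  have hdiag : star W * M * W = star Q * diagonal (fun k => (h.eigenvalues k : ℂ)) * Q := by
    rw [← h.star_eigenvectorUnitary_mul_mul, ← hU, hQ, star_mul, star_star]
    calc star W * M * W = star W * (U * star U) * M * (U * star U) * W := by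
          rw [Unitary.mul_star_self_of_mem hUu]; simp
      _ = _ := by simp only [mul_assoc]
  have hentry (j : n) : ((star W * M * W) j j).re =
      ∑ k, Complex.normSq (Q k j) • h.eigenvalues k := by
    rw [hdiag, mul_apply]
    simp only [mul_diagonal, star_apply, Complex.re_sum]
    refine Finset.sum_congr rfl fun k _ => ?_
    rw [mul_right_comm, mul_comm (star (Q k j)), Complex.star_def, Complex.mul_conj,
      ← Complex.ofReal_mul, Complex.ofReal_re, smul_eq_mul]
  have hQl : star Q * Q = 1 := Unitary.star_mul_self_of_mem hQu
  have hQr : Q * star Q = 1 := Unitary.mul_star_self_of_mem hQu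
  have hcol (j : n) : ∑ k, Complex.normSq (Q k j) = 1 := by
    have := congr_fun₂ hQl j j
    simp only [mul_apply, star_apply, one_apply_eq, Complex.star_def,
      ← Complex.normSq_eq_conj_mul_self] at this
    exact_mod_cast this
  have hrow (k : n) : ∑ j, Complex.normSq (Q k j) = 1 := by
    have := congr_fun₂ hQr k k
    simp only [mul_apply, star_apply, one_apply_eq, Complex.star_def, Complex.mul_conj] at this
    exact_mod_cast this
  rw [vN_eq_sum_negMulLog h]
  calc ∑ k, Real.negMulLog (h.eigenvalues k)
      = ∑ j, ∑ k, Complex.normSq (Q k j) • Real.negMulLog (h.eigenvalues k) := by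
        rw [Finset.sum_comm]
        refine Finset.sum_congr rfl fun k _ => ?_
        rw [← Finset.sum_smul, hrow, one_smul]
    _ ≤ _ := by
        refine Finset.sum_le_sum fun j _ => ?_
        rw [hentry]
        exact Real.concaveOn_negMulLog.le_map_sum (fun k _ => Complex.normSq_nonneg _) (hcol j)
          fun k _ => hM.eigenvalues_nonneg k

theorem Real.negMulLog_add_mul_log_le {p q : ℝ} (hp : 0 ≤ p) (hq : 0 ≤ q) (h : q = 0 → p = 0) :
    negMulLog p + p * log q ≤ q - p := by
  rcases hp.eq_or_lt with rfl | hp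
  · simpa using hq
  have hq : 0 < q := hq.lt_of_ne fun h0 => hp.ne' (h h0.symm)
  have := mul_le_mul_of_nonneg_left (log_le_sub_one_of_pos (div_pos hq hp)) hp.le
  rw [log_div hq.ne' hp.ne', mul_sub, mul_sub, mul_div_cancel₀ _ hp.ne'] at this
  rw [negMulLog]
  linarith

theorem Real.eq_of_negMulLog_add_mul_log_eq {p q : ℝ} (hp : 0 ≤ p) (hq : 0 < q)
    (h : negMulLog p + p * log q = q - p) : p = q := by
  rcases hp.eq_or_lt with rfl | hp
  · simpa using h
  by_contra hne
  have h1 : q / p ≠ 1 := fun h1 => hne ((div_eq_one_iff_eq hp.ne').1 h1).symm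
  have := mul_lt_mul_of_pos_left (log_lt_sub_one_of_pos (div_pos hq hp) h1) hp
  rw [log_div hq.ne' hp.ne', mul_sub, mul_sub, mul_div_cancel₀ _ hp.ne'] at this
  rw [negMulLog] at h
  linarith

/-- Subadditivity of the Shannon entropy. -/
theorem sum_negMulLog_le_add_marginals {α β : Type*} [Fintype α] [Fintype β] {p : α → β → ℝ}
    (hp : ∀ i j, 0 ≤ p i j) (hsum : ∑ i, ∑ j, p i j = 1) :
    ∑ i, ∑ j, Real.negMulLog (p i j) ≤
      ∑ i, Real.negMulLog (∑ j, p i j) + ∑ j, Real.negMulLog (∑ i, p i j) := by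
  set a : α → ℝ := fun i => ∑ j, p i j with ha
  set b : β → ℝ := fun j => ∑ i, p i j with hb
  have ha0 (i : α) : 0 ≤ a i := Finset.sum_nonneg fun j _ => hp i j
  have hb0 (j : β) : 0 ≤ b j := Finset.sum_nonneg fun i _ => hp i j
  have hpa (i : α) (j : β) (h : a i = 0) : p i j = 0 :=
    (Finset.sum_eq_zero_iff_of_nonneg fun j _ => hp i j).1 h j (Finset.mem_univ j)
  have hpb (i : α) (j : β) (h : b j = 0) : p i j = 0 :=
    (Finset.sum_eq_zero_iff_of_nonneg fun i _ => hp i j).1 h i (Finset.mem_univ i)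
  have key (i : α) (j : β) : Real.negMulLog (p i j) + p i j * Real.log (a i) +
      p i j * Real.log (b j) ≤ a i * b j - p i j := by
    by_cases h0 : p i j = 0
    · simpa [h0] using mul_nonneg (ha0 i) (hb0 j)
    · have := Real.negMulLog_add_mul_log_le (hp i j) (mul_nonneg (ha0 i) (hb0 j))
        fun h => (mul_eq_zero.1 h).elim (hpa i j) (hpb i j)
      rw [Real.log_mul (fun h => h0 (hpa i j h)) (fun h => h0 (hpb i j h))] at this
      linarith
  have total := Finset.sum_le_sum fun i (_ : i ∈ Finset.univ) =>
    Finset.sum_le_sum fun j (_ : j ∈ Finset.univ) => key i j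
  simp only [Finset.sum_add_distrib, Finset.sum_sub_distrib] at total
  have e1 : ∑ i, ∑ j, p i j * Real.log (a i) = -∑ i, Real.negMulLog (a i) := by
    simp [← Finset.sum_mul, Real.negMulLog, ha]
  have e2 : ∑ i, ∑ j, p i j * Real.log (b j) = -∑ j, Real.negMulLog (b j) := by
    rw [Finset.sum_comm]
    simp [← Finset.sum_mul, Real.negMulLog, hb]
  have hb1 : ∑ j, b j = 1 := by rw [← hsum, Finset.sum_comm]
  have e3 : ∑ i, ∑ j, a i * b j = 1 := by
    rw [← Finset.sum_mul_sum, hb1, mul_one, hsum]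
  rw [e1, e2, e3, hsum] at total
  linarith

section Entropy
variable {n : Type*} [Fintype n] [DecidableEq n] {M : Matrix n n ℂ}

theorem IsDensity.card_pos (h : IsDensity M) : 0 < Fintype.card n := by
  rw [Fintype.card_pos_iff]
  by_contra hn
  rw [not_nonempty_iff] at hn
  simpa [Matrix.trace] using h.2

theorem vN_le_log_card (h : IsDensity M) : vN M ≤ Real.log (Fintype.card n) := by
  have hc : (0 : ℝ) < Fintype.card n := by exact_mod_cast h.card_pos
  have total := Finset.sum_le_sum fun k (_ : k ∈ Finset.univ) =>
    Real.negMulLog_add_mul_log_le (h.1.eigenvalues_nonneg k) (inv_pos.2 hc).le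
      fun h0 => absurd h0 (inv_pos.2 hc).ne'
  rw [Finset.sum_add_distrib, ← Finset.sum_mul, Finset.sum_sub_distrib, h.sum_eigenvalues,
    ← vN_eq_sum_negMulLog, Real.log_inv] at total
  simp [hc.ne'] at total
  exact total

/-- Only the maximally mixed state has maximal entropy. -/
theorem eq_smul_one_of_vN_eq_log_card (h : IsDensity M) (hv : vN M = Real.log (Fintype.card n)) :
    M = (Fintype.card n : ℂ)⁻¹ • (1 : Matrix n n ℂ) := by
  have hc : (0 : ℝ) < Fintype.card n := by exact_mod_cast h.card_pos
  have hle (k : n) := Real.negMulLog_add_mul_log_le (h.1.eigenvalues_nonneg k) (inv_pos.2 hc).le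
      fun h0 => absurd h0 (inv_pos.2 hc).ne'
  have hs : ∑ k, (Real.negMulLog (h.1.1.eigenvalues k) +
      h.1.1.eigenvalues k * Real.log (Fintype.card n : ℝ)⁻¹) =
      ∑ k, ((Fintype.card n : ℝ)⁻¹ - h.1.1.eigenvalues k) := by
    rw [Finset.sum_add_distrib, ← Finset.sum_mul, Finset.sum_sub_distrib, h.sum_eigenvalues,
      ← vN_eq_sum_negMulLog, Real.log_inv, hv]
    simp [hc.ne']
  have heig (k : n) : h.1.1.eigenvalues k = (Fintype.card n : ℝ)⁻¹ :=
    Real.eq_of_negMulLog_add_mul_log_eq (h.1.eigenvalues_nonneg k) (inv_pos.2 hc)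
      ((Finset.sum_eq_sum_iff_of_le fun k _ => hle k).1 hs k (Finset.mem_univ k))
  have hd := h.1.1.star_eigenvectorUnitary_mul_mul
  set U : Matrix n n ℂ := (h.1.1.eigenvectorUnitary : Matrix n n ℂ) with hU
  have hUu : U * star U = 1 := Unitary.mul_star_self_of_mem h.1.1.eigenvectorUnitary.2
  calc M = (U * star U) * M * (U * star U) := by rw [hUu]; simp
    _ = U * (star U * M * U) * star U := by simp only [mul_assoc]
    _ = U * ((Fintype.card n : ℂ)⁻¹ • (1 : Matrix n n ℂ)) * star U := by
        rw [hd, smul_one_eq_diagonal]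
        simp [heig]
    _ = _ := by rw [Matrix.mul_smul, Matrix.smul_mul, mul_one, hUu]

theorem vN_eq_neg_log_of_mul_self_eq_smul (h : IsDensity M) {c : ℝ} (hM : M * M = (c : ℂ) • M) :
    vN M = -Real.log c := by
  have hd := h.1.1.star_eigenvectorUnitary_mul_mul
  set U : Matrix n n ℂ := (h.1.1.eigenvectorUnitary : Matrix n n ℂ) with hU
  have hUu : U * star U = 1 := Unitary.mul_star_self_of_mem h.1.1.eigenvectorUnitary.2
  have hsq : (star U * M * U) * (star U * M * U) = (c : ℂ) • (star U * M * U) := by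
    calc _ = star U * (M * (U * star U) * M) * U := by simp only [mul_assoc]
      _ = _ := by rw [hUu, mul_one, hM, Matrix.mul_smul, Matrix.smul_mul]
  rw [hd, diagonal_mul_diagonal] at hsq
  have heig (k : n) : h.1.1.eigenvalues k * h.1.1.eigenvalues k = c * h.1.1.eigenvalues k := by
    have := congr_fun₂ hsq k k
    simp only [diagonal_apply_eq, Matrix.smul_apply, smul_eq_mul] at this
    exact_mod_cast this
  have hlog (k : n) : Real.negMulLog (h.1.1.eigenvalues k) =
      h.1.1.eigenvalues k * -Real.log c := by
    by_cases h0 : h.1.1.eigenvalues k = 0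
    · simp [h0]
    · rw [Real.negMulLog, mul_right_cancel₀ h0 (heig k)]
      ring
  rw [vN_eq_sum_negMulLog h.1.1, Finset.sum_congr rfl fun k _ => hlog k, ← Finset.sum_mul,
    h.sum_eigenvalues, one_mul]

end Entropy

section PartialTrace
variable {α β : Type*} [Fintype α] [Fintype β]

/-- partial trace over the second factor -/
def ptraceSnd (M : Matrix (α × β) (α × β) ℂ) : Matrix α α ℂ :=
  Matrix.of fun a a' => ∑ b, M (a, b) (a', b)

/-- partial trace over the first factor -/
def ptraceFst (M : Matrix (α × β) (α × β) ℂ) : Matrix β β ℂ :=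
  Matrix.of fun b b' => ∑ a, M (a, b) (a, b')

omit [Fintype α] in
theorem ptraceSnd_posSemidef {M : Matrix (α × β) (α × β) ℂ} (h : M.PosSemidef) :
    (ptraceSnd M).PosSemidef := by
  have : ptraceSnd M = ∑ b, M.submatrix (fun a => (a, b)) fun a => (a, b) := by
    ext; simp [ptraceSnd, Matrix.sum_apply]
  rw [this]
  exact posSemidef_sum _ fun b _ => h.submatrix _

omit [Fintype β] in
theorem ptraceFst_posSemidef {M : Matrix (α × β) (α × β) ℂ} (h : M.PosSemidef) :
    (ptraceFst M).PosSemidef := by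
  have : ptraceFst M = ∑ a, M.submatrix (fun b => (a, b)) fun b => (a, b) := by
    ext; simp [ptraceFst, Matrix.sum_apply]
  rw [this]
  exact posSemidef_sum _ fun a _ => h.submatrix _

theorem IsDensity.ptraceSnd [DecidableEq α] [DecidableEq β] {M : Matrix (α × β) (α × β) ℂ}
    (h : IsDensity M) : IsDensity (ptraceSnd M) := by
  refine ⟨ptraceSnd_posSemidef h.1, ?_⟩
  rw [← h.2]
  simp [_root_.ptraceSnd, Matrix.trace, Fintype.sum_prod_type]

theorem IsDensity.ptraceFst [DecidableEq α] [DecidableEq β] {M : Matrix (α × β) (α × β) ℂ}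
    (h : IsDensity M) : IsDensity (ptraceFst M) := by
  refine ⟨ptraceFst_posSemidef h.1, ?_⟩
  rw [← h.2]
  simp only [_root_.ptraceFst, Matrix.trace, Fintype.sum_prod_type, Matrix.diag, Matrix.of_apply]
  exact Finset.sum_comm

open scoped Kronecker

theorem trace_mul_kronecker_one [DecidableEq β] (M : Matrix (α × β) (α × β) ℂ)
    (X : Matrix α α ℂ) :
    (M * (X ⊗ₖ (1 : Matrix β β ℂ))).trace = (ptraceSnd M * X).trace := by
  simp only [Matrix.trace, Matrix.diag, mul_apply, kroneckerMap_apply, one_apply, ptraceSnd,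
    Fintype.sum_prod_type, Matrix.of_apply, mul_ite, mul_one, mul_zero, Finset.sum_ite_eq',
    Finset.mem_univ, if_true, Finset.sum_mul]
  exact Finset.sum_congr rfl fun _ _ => Finset.sum_comm

theorem trace_mul_one_kronecker [DecidableEq α] (M : Matrix (α × β) (α × β) ℂ)
    (X : Matrix β β ℂ) :
    (M * ((1 : Matrix α α ℂ) ⊗ₖ X)).trace = (ptraceFst M * X).trace := by
  simp only [Matrix.trace, Matrix.diag, mul_apply, kroneckerMap_apply, one_apply, ptraceFst,
    Fintype.sum_prod_type, Matrix.of_apply, ite_mul, one_mul, zero_mul, mul_ite, mul_zero,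
    Finset.sum_mul, Finset.sum_ite_irrel, Finset.sum_const_zero, Finset.sum_ite_eq',
    Finset.mem_univ, if_true]
  rw [Finset.sum_comm]
  exact Finset.sum_congr rfl fun _ _ => Finset.sum_comm

variable [DecidableEq α] [DecidableEq β]

omit [DecidableEq α] in
theorem ptraceSnd_conj (M : Matrix (α × β) (α × β) ℂ) (A : Matrix α α ℂ) {B : Matrix β β ℂ}
    (hB : B ∈ unitary (Matrix β β ℂ)) :
    ptraceSnd (star (A ⊗ₖ B) * M * (A ⊗ₖ B)) = star A * ptraceSnd M * A := by
  rw [Matrix.ext_iff_trace_mul_right]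
  intro X
  rw [← trace_mul_kronecker_one, mul_assoc, mul_assoc, Matrix.trace_mul_comm, star_eq_conjTranspose,
    conjTranspose_kronecker, mul_assoc, mul_assoc, ← mul_kronecker_mul, ← mul_kronecker_mul,
    one_mul, ← star_eq_conjTranspose B, Unitary.mul_star_self_of_mem hB, trace_mul_kronecker_one,
    ← mul_assoc, ← mul_assoc, Matrix.trace_mul_comm, star_eq_conjTranspose]
  simp only [mul_assoc]

omit [DecidableEq β] in
theorem ptraceFst_conj (M : Matrix (α × β) (α × β) ℂ) {A : Matrix α α ℂ} (B : Matrix β β ℂ)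
    (hA : A ∈ unitary (Matrix α α ℂ)) :
    ptraceFst (star (A ⊗ₖ B) * M * (A ⊗ₖ B)) = star B * ptraceFst M * B := by
  rw [Matrix.ext_iff_trace_mul_right]
  intro X
  rw [← trace_mul_one_kronecker, mul_assoc, mul_assoc, Matrix.trace_mul_comm, star_eq_conjTranspose,
    conjTranspose_kronecker, mul_assoc, mul_assoc, ← mul_kronecker_mul, ← mul_kronecker_mul,
    one_mul, ← star_eq_conjTranspose A, Unitary.mul_star_self_of_mem hA, trace_mul_one_kronecker,
    ← mul_assoc, ← mul_assoc, Matrix.trace_mul_comm, star_eq_conjTranspose]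
  simp only [mul_assoc]

/-- Subadditivity of the von Neumann entropy. -/
theorem vN_le_add_ptrace {M : Matrix (α × β) (α × β) ℂ} (h : IsDensity M) :
    vN M ≤ vN (ptraceSnd M) + vN (ptraceFst M) := by
  have hA := h.ptraceSnd.1.1
  have hB := h.ptraceFst.1.1
  have hAu := hA.eigenvectorUnitary.2
  have hBu := hB.eigenvectorUnitary.2
  have hAd := hA.star_eigenvectorUnitary_mul_mul
  have hBd := hB.star_eigenvectorUnitary_mul_mul
  rw [vN_eq_sum_negMulLog hA, vN_eq_sum_negMulLog hB]
  set A : Matrix α α ℂ := (hA.eigenvectorUnitary : Matrix α α ℂ)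
  set B : Matrix β β ℂ := (hB.eigenvectorUnitary : Matrix β β ℂ)
  have hW : A ⊗ₖ B ∈ unitary (Matrix (α × β) (α × β) ℂ) := kronecker_mem_unitary hAu hBu
  rw [← ptraceSnd_conj M A hBu] at hAd
  rw [← ptraceFst_conj M B hAu] at hBd
  have hle := vN_le_sum_negMulLog_diag h.1 hW
  have hN : (star (A ⊗ₖ B) * M * (A ⊗ₖ B)).PosSemidef := h.1.conjTranspose_mul_mul_same _
  set N := star (A ⊗ₖ B) * M * (A ⊗ₖ B)
  have hrow (i : α) : ∑ j, (N (i, j) (i, j)).re = hA.eigenvalues i := by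
    have := congr_arg Complex.re (congr_fun₂ hAd i i)
    simpa [ptraceSnd] using this
  have hcol (j : β) : ∑ i, (N (i, j) (i, j)).re = hB.eigenvalues j := by
    have := congr_arg Complex.re (congr_fun₂ hBd j j)
    simpa [ptraceFst] using this
  rw [Fintype.sum_prod_type] at hle
  refine hle.trans ?_
  have := sum_negMulLog_le_add_marginals (p := fun i j => (N (i, j) (i, j)).re)
    (fun i j => (Complex.le_def.1 hN.diag_nonneg).1)
    (by simp only [hrow]; exact h.ptraceSnd.sum_eigenvalues)
  simpa only [hrow, hcol] using this

end PartialTrace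

/-- If the maximally mixed state on the span of `v` has maximally mixed marginal on `β`, then
every operator on the span of `v` has marginal on `α` proportional to the identity. -/
theorem sum_mul_star_eq_of_marginal {ι α β : Type*} [Fintype ι] [Fintype α] [Fintype β]
    [DecidableEq ι] [DecidableEq α] [DecidableEq β]
    (hcard : Fintype.card ι * Fintype.card α = Fintype.card β)
    (v : ι → α → β → ℂ) {c : ℂ} (hc : c ≠ 0)
    (h : ∀ b b', ∑ i, ∑ a, v i a b * star (v i a b') = if b = b' then c else 0)
    (K : Matrix ι ι ℂ) (a a' : α) :
    ∑ b, ∑ i, ∑ j, v i a b * K i j * star (v j a' b) = if a = a' then c * K.trace else 0 := by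
  let T : Matrix β (ι × α) ℂ := Matrix.of fun b x => v x.1 x.2 b
  have hT : T * (c⁻¹ • Tᴴ) = 1 := by
    ext b b'
    simp only [T, mul_apply, Fintype.sum_prod_type, Matrix.smul_apply, conjTranspose_apply,
      Matrix.of_apply, smul_eq_mul, one_apply, mul_left_comm _ c⁻¹, ← Finset.mul_sum, h]
    split_ifs <;> simp [hc]
  have hT' : (c⁻¹ • Tᴴ) * T = 1 :=
    (mul_eq_one_comm_of_card_eq _ _ _ (by rw [Fintype.card_prod, hcard])).1 hT
  have hgram (i j : ι) : ∑ b, v i a b * star (v j a' b) = if i = j ∧ a = a' then c else 0 := by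
    have := congr_fun₂ hT' (j, a') (i, a)
    simp only [T, mul_apply, Matrix.smul_apply, conjTranspose_apply, Matrix.of_apply, smul_eq_mul,
      one_apply, mul_assoc, ← Finset.mul_sum, Prod.mk.injEq] at this
    rw [inv_mul_eq_iff_eq_mul₀ hc] at this
    simp only [mul_comm (v i a _), this, mul_ite, mul_one, mul_zero, eq_comm (a := j),
      eq_comm (a := a')]
  calc ∑ b, ∑ i, ∑ j, v i a b * K i j * star (v j a' b)
      = ∑ i, ∑ j, K i j * ∑ b, v i a b * star (v j a' b) := by
        rw [Finset.sum_comm]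
        refine Finset.sum_congr rfl fun i _ => ?_
        rw [Finset.sum_comm]
        refine Finset.sum_congr rfl fun j _ => ?_
        rw [Finset.mul_sum]
        exact Finset.sum_congr rfl fun b _ => by ring
    _ = _ := by
        simp only [hgram]
        by_cases haa : a = a' <;> simp [haa, Matrix.trace, Finset.mul_sum, mul_comm]

/-- A Hermitian matrix supported in the span of an orthonormal family is determined by its
coefficients with respect to that family. -/
theorem exists_coeff_of_suppIn {ι X : Type*} [Fintype ι] [DecidableEq ι] [Fintype X]
    [DecidableEq X] {v : ι → X → ℂ} (hon : ONFam v) {ρ : Matrix X X ℂ} (hρ : ρ.IsHermitian)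
    (hsupp : SuppIn ρ v) :
    ∃ K : Matrix ι ι ℂ, K.trace = ρ.trace ∧
      ∀ x y, ρ x y = ∑ i, ∑ j, v i x * K i j * star (v j y) := by
  let V : Matrix X ι ℂ := Matrix.of fun x i => v i x
  have hV : Vᴴ * V = 1 := by
    ext i j
    simp only [V, mul_apply, conjTranspose_apply, Matrix.of_apply, one_apply]
    exact hon i j
  have hcol (y : X) : ∃ c : ι → ℂ, ∀ x, ρ x y = ∑ i, v i x * c i := by
    have hmem := hsupp ⟨Pi.single y 1, rfl⟩
    rw [Submodule.mem_span_range_iff_exists_fun] at hmem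
    obtain ⟨c, hc⟩ := hmem
    refine ⟨c, fun x => ?_⟩
    have := congr_fun hc x
    simp only [mulVecLin_apply, mulVec_single_one, Finset.sum_apply, Pi.smul_apply, smul_eq_mul,
      col_apply] at this
    rw [← this]
    exact Finset.sum_congr rfl fun i _ => mul_comm _ _
  choose c hc using hcol
  have hC : ρ = V * Matrix.of fun i y => c y i := by
    ext x y
    simp [V, mul_apply, hc]
  have hleft : V * Vᴴ * ρ = ρ := by
    rw [hC, Matrix.mul_assoc, ← Matrix.mul_assoc Vᴴ, hV, Matrix.one_mul]
  have hright : ρ * (V * Vᴴ) = ρ := by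
    have := congr_arg conjTranspose hleft
    simpa [conjTranspose_mul, hρ.eq] using this
  have hK : ρ = V * (Vᴴ * ρ * V) * Vᴴ := by
    calc ρ = V * Vᴴ * (ρ * (V * Vᴴ)) := by rw [hright, hleft]
      _ = _ := by simp only [Matrix.mul_assoc]
  refine ⟨Vᴴ * ρ * V, ?_, fun x y => ?_⟩
  · rw [Matrix.trace_mul_comm, ← Matrix.mul_assoc, hleft]
  · conv_lhs => rw [hK]
    generalize Vᴴ * ρ * V = K
    simp only [V, mul_apply, conjTranspose_apply, Matrix.of_apply, Finset.sum_mul]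
    exact Finset.sum_comm

theorem isDensity_smul_sum_outer {X : Type*} [Fintype X] [DecidableEq X] {d : ℕ} (hd : 1 ≤ d)
    {v : Fin d → X → ℂ} (hon : ONFam v) : IsDensity ((d : ℂ)⁻¹ • ∑ i, outer (v i) (v i)) := by
  have hd0 : (d : ℂ) ≠ 0 := by exact_mod_cast (by omega : d ≠ 0)
  refine ⟨(posSemidef_sum _ fun i _ => posSemidef_vecMulVec_self_star (v i)).smul ?_, ?_⟩
  · rw [← Complex.ofReal_natCast, ← Complex.ofReal_inv]
    exact Complex.zero_le_real.2 (by positivity)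
  · have (i : Fin d) : (outer (v i) (v i)).trace = 1 := by
      have := hon i i
      simp only [if_true] at this
      simp only [← this, Matrix.trace, outer, Matrix.diag, Matrix.of_apply, mul_comm]
    simp [Matrix.trace_smul, Matrix.trace_sum, this, hd0]

theorem smul_sum_outer_mul_self {X : Type*} [Fintype X] {d : ℕ}
    {v : Fin d → X → ℂ} (hon : ONFam v) (c : ℂ) :
    (c • ∑ i, outer (v i) (v i)) * (c • ∑ i, outer (v i) (v i)) =
      c • c • ∑ i, outer (v i) (v i) := by
  have hmul (i j : Fin d) :
      outer (v i) (v i) * outer (v j) (v j) = if i = j then outer (v i) (v i) else 0 := by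
    have (x y : X) : (outer (v i) (v i) * outer (v j) (v j)) x y =
        v i x * (∑ z, star (v i z) * v j z) * star (v j y) := by
      simp only [outer, mul_apply, Matrix.of_apply, Finset.mul_sum, Finset.sum_mul, mul_assoc]
    ext x y
    rw [this, hon i j]
    split_ifs with hij
    · simp [outer, hij]
    · simp
  simp [Matrix.smul_mul, Matrix.mul_smul, Finset.sum_mul, Finset.mul_sum, hmul, Finset.smul_sum]

section Tripartite
variable {α β γ : Type*} [Fintype α] [Fintype β] [Fintype γ]
  (ρ : Matrix (α × β × γ) (α × β × γ) ℂ)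

omit [Fintype α] in
theorem red1_eq_ptraceSnd_red12 : red1 ρ = ptraceSnd (red12 ρ) := rfl

omit [Fintype β] in
theorem red2_eq_ptraceFst_red12 : red2 ρ = ptraceFst (red12 ρ) := rfl

omit [Fintype α] in
theorem red1_eq_ptraceSnd_red13 : red1 ρ = ptraceSnd (red13 ρ) := by
  ext; exact Finset.sum_comm

omit [Fintype γ] in
theorem red3_eq_ptraceFst_red13 : red3 ρ = ptraceFst (red13 ρ) := rfl

omit [Fintype β] in
theorem red2_eq_ptraceSnd_red23 : red2 ρ = ptraceSnd (red23 ρ) := by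
  ext; exact Finset.sum_comm

omit [Fintype γ] in
theorem red3_eq_ptraceFst_red23 : red3 ρ = ptraceFst (red23 ρ) := by
  ext; exact Finset.sum_comm

variable {ρ} [DecidableEq α] [DecidableEq β] [DecidableEq γ]

theorem IsDensity.red12 (h : IsDensity ρ) : IsDensity (red12 ρ) := by
  constructor
  · have : _root_.red12 ρ = ∑ c, ρ.submatrix (fun x : α × β => (x.1, x.2, c))
        fun x => (x.1, x.2, c) := by
      ext; simp [_root_.red12, Matrix.sum_apply]
    rw [this]
    exact posSemidef_sum _ fun c _ => h.1.submatrix _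
  · rw [← h.2]
    simp [_root_.red12, Matrix.trace, Fintype.sum_prod_type]

theorem IsDensity.red13 (h : IsDensity ρ) : IsDensity (red13 ρ) := by
  constructor
  · have : _root_.red13 ρ = ∑ b, ρ.submatrix (fun x : α × γ => (x.1, b, x.2))
        fun x => (x.1, b, x.2) := by
      ext; simp [_root_.red13, Matrix.sum_apply]
    rw [this]
    exact posSemidef_sum _ fun c _ => h.1.submatrix _
  · rw [← h.2]
    simp only [_root_.red13, Matrix.trace, Fintype.sum_prod_type, Matrix.diag, Matrix.of_apply]
    exact Finset.sum_congr rfl fun _ _ => Finset.sum_comm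

theorem IsDensity.red23 (h : IsDensity ρ) : IsDensity (red23 ρ) := h.ptraceFst

end Tripartite


/-- if the maximally mixed density on a `d`-dimensional code space in
`(ℂ^d)⊗(ℂ^d)⊗(ℂ^d)` has minimal tripartite information `I₃ = −2 log d`, then all single-party
reduced densities of any density matrix supported in the code space are maximally mixed. -/
theorem stmt5 (d : ℕ) (hd : 1 ≤ d)
    (v : Fin d → (Fin d × Fin d × Fin d) → ℂ) (hon : ONFam v)
    (hmin : I3 ((d : ℂ)⁻¹ • ∑ i, outer (v i) (v i)) = -2 * Real.log d)
    (ρ : Matrix (Fin d × Fin d × Fin d) (Fin d × Fin d × Fin d) ℂ)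
    (hρ : IsDensity ρ) (hsupp : SuppIn ρ v) (a : Fin 3) :
    ![ red1 ρ = (d : ℂ)⁻¹ • (1 : Matrix (Fin d) (Fin d) ℂ),
       red2 ρ = (d : ℂ)⁻¹ • (1 : Matrix (Fin d) (Fin d) ℂ),
       red3 ρ = (d : ℂ)⁻¹ • (1 : Matrix (Fin d) (Fin d) ℂ)] a := by
  have hd0 : (d : ℂ) ≠ 0 := by exact_mod_cast (by omega : d ≠ 0)
  set ρ₀ := (d : ℂ)⁻¹ • ∑ i, outer (v i) (v i) with hρ₀
  have hD : IsDensity ρ₀ := isDensity_smul_sum_outer hd hon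
  have hS : vN ρ₀ = Real.log d := by
    rw [vN_eq_neg_log_of_mul_self_eq_smul hD (c := (d : ℝ)⁻¹), Real.log_inv, neg_neg]
    push_cast
    exact smul_sum_outer_mul_self hon _
  have s12 := vN_le_add_ptrace hD.red12
  have s13 := vN_le_add_ptrace hD.red13
  have s23 := vN_le_add_ptrace hD.red23
  rw [← red1_eq_ptraceSnd_red12, ← red2_eq_ptraceFst_red12] at s12
  rw [← red1_eq_ptraceSnd_red13, ← red3_eq_ptraceFst_red13] at s13
  rw [← red2_eq_ptraceSnd_red23, ← red3_eq_ptraceFst_red23] at s23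
  have t1 : vN (red1 ρ₀) ≤ Real.log d := by
    rw [red1_eq_ptraceSnd_red12]
    simpa only [Fintype.card_fin] using vN_le_log_card hD.red12.ptraceSnd
  have t2 : vN (red2 ρ₀) ≤ Real.log d := by
    rw [red2_eq_ptraceFst_red12]
    simpa only [Fintype.card_fin] using vN_le_log_card hD.red12.ptraceFst
  have t3 : vN (red3 ρ₀) ≤ Real.log d := by
    rw [red3_eq_ptraceFst_red13]
    simpa only [Fintype.card_fin] using vN_le_log_card hD.red13.ptraceFst
  have hlog : Real.log (Fintype.card (Fin d × Fin d)) = Real.log d + Real.log d := by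
    have : (d : ℝ) ≠ 0 := by exact_mod_cast (by omega : d ≠ 0)
    simp [Real.log_mul this this]
  have u12 := vN_le_log_card hD.red12
  have u13 := vN_le_log_card hD.red13
  have u23 := vN_le_log_card hD.red23
  rw [I3] at hmin
  have e12 := eq_smul_one_of_vN_eq_log_card hD.red12 (by linarith)
  have e13 := eq_smul_one_of_vN_eq_log_card hD.red13 (by linarith)
  have e23 := eq_smul_one_of_vN_eq_log_card hD.red23 (by linarith)
  obtain ⟨K, hKtr, hK⟩ := exists_coeff_of_suppIn hon hρ.1.1 hsupp
  rw [hρ.2] at hKtr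
  have hcard : Fintype.card (Fin d) * Fintype.card (Fin d) = Fintype.card (Fin d × Fin d) := by
    simp
  have hentry (x y : Fin d × Fin d × Fin d) :
      ρ₀ x y = (d : ℂ)⁻¹ * ∑ i, v i x * star (v i y) := by
    simp [hρ₀, Matrix.sum_apply, outer]
  have hscale {s : ℂ} {p : Prop} [Decidable p] (h : (d : ℂ)⁻¹ * s =
      (Fintype.card (Fin d × Fin d) : ℂ)⁻¹ * if p then 1 else 0) :
      s = if p then (d : ℂ)⁻¹ else 0 := by
    rw [inv_mul_eq_iff_eq_mul₀ hd0] at h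
    rw [h]
    split_ifs <;> simp [hd0]
  have h1 : red1 ρ = (d : ℂ)⁻¹ • (1 : Matrix (Fin d) (Fin d) ℂ) := by
    ext a a'
    have := sum_mul_star_eq_of_marginal hcard (fun i a (b : Fin d × Fin d) => v i (a, b.1, b.2))
      (inv_ne_zero hd0) (fun b b' => by
        have := congr_fun₂ e23 b b'
        simp only [red23, Matrix.of_apply, hentry, ← Finset.mul_sum, Matrix.smul_apply,
          Matrix.one_apply, smul_eq_mul] at this
        rw [Finset.sum_comm]
        exact hscale this) K a a'
    simpa [red1, hK, Fintype.sum_prod_type, hKtr, Matrix.one_apply] using this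
  have h2 : red2 ρ = (d : ℂ)⁻¹ • (1 : Matrix (Fin d) (Fin d) ℂ) := by
    ext a a'
    have := sum_mul_star_eq_of_marginal hcard (fun i a (b : Fin d × Fin d) => v i (b.1, a, b.2))
      (inv_ne_zero hd0) (fun b b' => by
        have := congr_fun₂ e13 b b'
        simp only [red13, Matrix.of_apply, hentry, ← Finset.mul_sum, Matrix.smul_apply,
          Matrix.one_apply, smul_eq_mul] at this
        rw [Finset.sum_comm]
        exact hscale this) K a a'
    simpa [red2, hK, Fintype.sum_prod_type, hKtr, Matrix.one_apply] using this
  have h3 : red3 ρ = (d : ℂ)⁻¹ • (1 : Matrix (Fin d) (Fin d) ℂ) := by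
    ext a a'
    have := sum_mul_star_eq_of_marginal hcard (fun i a (b : Fin d × Fin d) => v i (b.1, b.2, a))
      (inv_ne_zero hd0) (fun b b' => by
        have := congr_fun₂ e12 b b'
        simp only [red12, Matrix.of_apply, hentry, ← Finset.mul_sum, Matrix.smul_apply,
          Matrix.one_apply, smul_eq_mul] at this
        rw [Finset.sum_comm]
        exact hscale this) K a a'
    simpa [red3, hK, Fintype.sum_prod_type, hKtr, Matrix.one_apply] using this
  fin_cases a
  · exact h1
  · exact h2
  · exact h3
end
end
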